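/- arXiv:1902.00823 — 4 statements merged into one kernel-verified Lean document; each statement's English description precedes it below -/
import Mathlib

section
/- For all real numbers x with 0 ≤ x ≤ 1 and all real t with t ≥ 1, one has (1+t)^x ≥ 1 + (2^x − 1)·t^x. -/
/-- Lemma 3.1: for `0 ≤ x ≤ 1` and `t ≥ 1`, `(1+t)^x ≥ 1 + (2^x - 1) * t^x`. -/
theorem lemma_3_1 (x t : ℝ) (hx0 : 0 ≤ x) (hx1 : x ≤ 1) (ht : 1 ≤ t) :
    (1 + t) ^ x ≥ 1 + (2 ^ x - 1) * t ^ x := by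
  have hc := (Real.concaveOn_rpow hx0 hx1).2
  have hd : 0 < 2 * t - 1 := by linarith
  have h1 : (1 : ℝ) ∈ Set.Ici (0 : ℝ) := Set.mem_Ici.2 zero_le_one
  have h2 : 2 * t ∈ Set.Ici (0 : ℝ) := by
    rw [Set.mem_Ici]
    linarith
  -- Both `t` and `1 + t` are convex combinations of `1` and `2 * t`, with weights swapped.
  obtain ⟨a, b, ha, hb, hab, hat⟩ :
      ∃ a b : ℝ, 0 ≤ a ∧ 0 ≤ b ∧ a + b = 1 ∧ a * (2 * t - 1) = t - 1 :=
    ⟨(t - 1) / (2 * t - 1), t / (2 * t - 1), div_nonneg (by linarith) hd.le,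
      div_nonneg (by linarith) hd.le, by
        rw [← add_div, div_eq_one_iff_eq hd.ne']
        ring, div_mul_cancel₀ _ hd.ne'⟩
  obtain rfl : b = 1 - a := by linarith
  have e1 : a * 1 + (1 - a) * (2 * t) = 1 + t := by linear_combination -hat
  have e2 : (1 - a) * 1 + a * (2 * t) = t := by linear_combination hat
  have k1 := hc h1 h2 ha hb hab
  have k2 := hc h1 h2 hb ha (by ring)
  simp only [smul_eq_mul, e1, e2, Real.one_rpow] at k1 k2
  rw [Real.mul_rpow zero_le_two (by linarith)] at k1 k2
  linarith
end

section
/- Let a, b, c be nonnegative real numbers satisfying c² = a² + b², and let α, β be real numbers with α ≥ 2 and 0 ≤ β ≤ α. Then c^β ≥ (2^{β/α} − 1)·max(a, b)^β + min(a, b)^β. -/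
/-- A concave function takes smaller values in total at the outer pair `y, 2 * x` than at the
inner pair `x, x + y`, which has the same sum; here for the power function. -/
theorem two_mul_rpow_add_rpow_le {x y t : ℝ} (hy : 0 ≤ y) (hyx : y ≤ x) (ht0 : 0 ≤ t)
    (ht1 : t ≤ 1) : (2 * x) ^ t + y ^ t ≤ (x + y) ^ t + x ^ t := by
  rcases (hy.trans hyx).eq_or_lt with rfl | hx
  · obtain rfl : y = 0 := le_antisymm hyx hy
    simp
  have hd : 0 < 2 * x - y := by linarith
  have hconc := Real.concaveOn_rpow ht0 ht1
  have hl0 : 0 ≤ x / (2 * x - y) := by positivity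
  have hm0 : 0 ≤ (x - y) / (2 * x - y) := div_nonneg (by linarith) hd.le
  have hy' : y ∈ Set.Ici (0 : ℝ) := hy
  have hx' : 2 * x ∈ Set.Ici (0 : ℝ) := Set.mem_Ici.2 (by linarith)
  have hsum : x / (2 * x - y) + (x - y) / (2 * x - y) = 1 := by
    rw [← add_div, div_eq_one_iff_eq hd.ne']; ring
  have h1 := hconc.2 hy' hx' hl0 hm0 hsum
  have h2 := hconc.2 hx' hy' hl0 hm0 hsum
  simp only [smul_eq_mul] at h1 h2
  have e1 : x / (2 * x - y) * y + (x - y) / (2 * x - y) * (2 * x) = x := by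
    rw [div_mul_eq_mul_div, div_mul_eq_mul_div, ← add_div, div_eq_iff hd.ne']; ring
  have e2 : x / (2 * x - y) * (2 * x) + (x - y) / (2 * x - y) * y = x + y := by
    rw [div_mul_eq_mul_div, div_mul_eq_mul_div, ← add_div, div_eq_iff hd.ne']; ring
  rw [e1] at h1
  rw [e2] at h2
  linear_combination h1 + h2 - ((2 * x) ^ t + y ^ t) * hsum

theorem rpow_add_rpow_le_of_sq_eq {a b c p : ℝ} (ha : 0 ≤ a) (hb : 0 ≤ b) (hc : 0 ≤ c)
    (hsq : c ^ 2 = a ^ 2 + b ^ 2) (hp : 2 ≤ p) : a ^ p + b ^ p ≤ c ^ p := by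
  have key : ∀ {x : ℝ}, 0 ≤ x → (x ^ 2) ^ (p / 2) = x ^ p := fun {x} hx => by
    rw [← Real.rpow_natCast, ← Real.rpow_mul hx]
    congr 1
    push_cast
    ring
  rw [← key ha, ← key hb, ← key hc, hsq]
  exact Real.add_rpow_le_rpow_add (sq_nonneg a) (sq_nonneg b) (by linarith)

/-- Theorem 3.2 / 4.1 (numerical content): if `a, b, c ≥ 0` with `c² = a² + b²`, `α ≥ 2`
and `0 ≤ β ≤ α`, then `c^β ≥ (2^(β/α) - 1) * (max a b)^β + (min a b)^β`. -/
theorem theorem_3_2 (a b c α β : ℝ) (ha : 0 ≤ a) (hb : 0 ≤ b) (hc : 0 ≤ c)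
    (hsq : c ^ 2 = a ^ 2 + b ^ 2) (hα : 2 ≤ α) (hβ0 : 0 ≤ β) (hβα : β ≤ α) :
    c ^ β ≥ (2 ^ (β / α) - 1) * (max a b) ^ β + (min a b) ^ β := by
  wlog hab : b ≤ a generalizing a b
  · rw [max_comm, min_comm]
    exact this b a hb ha (by rw [hsq, add_comm]) (le_of_not_ge hab)
  rw [max_eq_left hab, min_eq_right hab]
  have hα0 : 0 < α := by linarith
  have ht0 : 0 ≤ β / α := by positivity
  have ht1 : β / α ≤ 1 := (div_le_one hα0).2 hβα
  have key : ∀ {x : ℝ}, 0 ≤ x → (x ^ α) ^ (β / α) = x ^ β := fun {x} hx => by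
    rw [← Real.rpow_mul hx, mul_div_cancel₀ _ hα0.ne']
  have hA : 0 ≤ a ^ α := Real.rpow_nonneg ha α
  have hB : 0 ≤ b ^ α := Real.rpow_nonneg hb α
  have h1 := Real.rpow_le_rpow (by positivity) (rpow_add_rpow_le_of_sq_eq ha hb hc hsq hα) ht0
  have h2 := two_mul_rpow_add_rpow_le hB (Real.rpow_le_rpow hb hab hα0.le) ht0 ht1
  rw [Real.mul_rpow zero_le_two hA, key ha, key hb] at h2
  rw [key hc] at h1
  linarith
end

section
/- For every real number β with 0 ≤ β ≤ 2, one has (√5/3)^β ≥ (2^{β/2} − 1)·(2/3)^β + (1/3)^β. -/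
/-- Concavity of `x ↦ x ^ t` applied to `4` and `5`, which lie between `1` and `8` and have
the same sum. -/
theorem one_add_eight_rpow_le {t : ℝ} (ht0 : 0 ≤ t) (ht1 : t ≤ 1) :
    1 + (8 : ℝ) ^ t ≤ 4 ^ t + 5 ^ t := by
  have hc := (Real.concaveOn_rpow ht0 ht1).2
  have h1 : (1 : ℝ) ∈ Set.Ici (0 : ℝ) := by simp
  have h8 : (8 : ℝ) ∈ Set.Ici (0 : ℝ) := by simp
  have h4 := hc h1 h8 (a := 4 / 7) (b := 3 / 7) (by norm_num) (by norm_num) (by norm_num)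
  have h5 := hc h1 h8 (a := 3 / 7) (b := 4 / 7) (by norm_num) (by norm_num) (by norm_num)
  norm_num at h4 h5
  linarith

theorem div_three_rpow_eq {a : ℝ} (ha : 0 ≤ a) (β : ℝ) :
    (a / 3) ^ β = (a ^ 2) ^ (β / 2) / 9 ^ (β / 2) := by
  rw [← Real.div_rpow (by positivity) (by norm_num),
    show a ^ 2 / 9 = (a / 3) ^ (2 : ℝ) by rw [Real.rpow_two]; ring,
    ← Real.rpow_mul (by positivity)]
  congr 1
  ring

/-- Example 3.3: for all `0 ≤ β ≤ 2`,
`(√5/3)^β ≥ (2^(β/2) - 1) * (2/3)^β + (1/3)^β`. -/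
theorem example_3_3 (β : ℝ) (hβ0 : 0 ≤ β) (hβ2 : β ≤ 2) :
    (Real.sqrt 5 / 3) ^ β ≥ (2 ^ (β / 2) - 1) * ((2 : ℝ) / 3) ^ β + ((1 : ℝ) / 3) ^ β := by
  have hconc := one_add_eight_rpow_le (t := β / 2) (by linarith) (by linarith)
  have h8 : (8 : ℝ) ^ (β / 2) = 2 ^ (β / 2) * 4 ^ (β / 2) := by
    rw [← Real.mul_rpow (by norm_num) (by norm_num)]
    norm_num
  rw [div_three_rpow_eq (Real.sqrt_nonneg 5), div_three_rpow_eq zero_le_two,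
    div_three_rpow_eq zero_le_one, Real.sq_sqrt (by norm_num), one_pow, Real.one_rpow,
    show (2 : ℝ) ^ 2 = 4 by norm_num, ge_iff_le, ← mul_div_assoc, ← add_div]
  gcongr
  linarith
end

section
/- Let m ≥ 3 and let a₁, …, a_{m−1}, c be nonnegative real numbers satisfying c² = a₁² + ⋯ + a_{m−1}². Let 1 ≤ n ≤ m−1 and suppose that a_i² ≤ a_{i+1}² + ⋯ + a_{m−1}² for all i = 1, …, n−1, and a_j² ≥ a_{j+1}² + ⋯ + a_{m−1}² for all j = n, …, m−2. Let α, β be real numbers with α ≥ 2 and 0 ≤ β ≤ α, and set h = 2^{β/α} − 1. Then c^β ≥ Σ_{i=1}^{n−1} h^{i−1}·a_i^β + h^n·Σ_{i=n}^{m−2} a_i^β + h^{n−1}·a_{m−1}^β. -/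
/-- A concave power satisfies the exchange inequality for `x ≤ y` and `x + y ≤ 2 * y`. -/
lemma rpow_add_two_rpow_sub_one_mul_le {x y t : ℝ} (hx : 0 ≤ x) (hxy : x ≤ y)
    (ht0 : 0 ≤ t) (ht1 : t ≤ 1) :
    x ^ t + (2 ^ t - 1) * y ^ t ≤ (x + y) ^ t := by
  have hy : 0 ≤ y := hx.trans hxy
  have key : x ^ t + (2 * y) ^ t ≤ (x + y) ^ t + y ^ t := by
    rcases hy.eq_or_lt with rfl | hy'
    · obtain rfl : x = 0 := le_antisymm hxy hx
      simp
    · have hd : 0 < 2 * y - x := by linarith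
      have hconc := (Real.concaveOn_rpow ht0 ht1).2
      have hx' : x ∈ Set.Ici (0 : ℝ) := hx
      have hy2 : 2 * y ∈ Set.Ici (0 : ℝ) := by simp [hy]
      obtain ⟨p, hp⟩ : ∃ p, p = y / (2 * y - x) := ⟨_, rfl⟩
      have hp0 : 0 ≤ p := hp ▸ div_nonneg hy hd.le
      have hp1 : 0 ≤ 1 - p := by
        rw [hp, sub_nonneg, div_le_one hd]
        linarith
      have hpmul : p * (2 * y - x) = y := hp ▸ div_mul_cancel₀ y hd.ne'
      have h₁ := hconc hx' hy2 hp0 hp1 (by ring)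
      have h₂ := hconc hx' hy2 hp1 hp0 (by ring)
      simp only [smul_eq_mul] at h₁ h₂
      rw [show p * x + (1 - p) * (2 * y) = y by linear_combination -hpmul] at h₁
      rw [show (1 - p) * x + p * (2 * y) = x + y by linear_combination hpmul] at h₂
      linear_combination h₁ + h₂
  rw [Real.mul_rpow zero_le_two hy] at key
  linarith

/-- The two-term inequality in terms of the squares `x = a ^ 2 ≤ y = b ^ 2`. -/
lemma rpow_half_add_mul_rpow_half_le {x y α β : ℝ} (hx : 0 ≤ x) (hxy : x ≤ y)
    (hα : 2 ≤ α) (hβ0 : 0 ≤ β) (hβα : β ≤ α) :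
    x ^ (β / 2) + (2 ^ (β / α) - 1) * y ^ (β / 2) ≤ (x + y) ^ (β / 2) := by
  have hy : 0 ≤ y := hx.trans hxy
  have hα0 : 0 < α := by linarith
  have ht0 : 0 ≤ β / α := by positivity
  have ht1 : β / α ≤ 1 := (div_le_one hα0).2 hβα
  have hs : β / 2 = α / 2 * (β / α) := by field_simp
  rw [hs, Real.rpow_mul hx, Real.rpow_mul hy, Real.rpow_mul (add_nonneg hx hy)]
  refine (rpow_add_two_rpow_sub_one_mul_le (by positivity)
    (Real.rpow_le_rpow hx hxy (by positivity)) ht0 ht1).trans ?_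
  exact Real.rpow_le_rpow (by positivity)
    (Real.add_rpow_le_rpow_add hx hy (by linarith)) ht0

open Finset in
/-- Theorem 3.4 / 4.2 (numerical content): iterated monogamy inequality.
`a 1, …, a (m-1)` are nonnegative, `c² = a 1 ² + ⋯ + a (m-1) ²`,
the first `n-1` of them are each dominated by the sum of squares of the later ones,
and from index `n` to `m-2` each dominates the sum of squares of the later ones.
Then with `h = 2^(β/α) - 1`,
`c^β ≥ ∑_{i=1}^{n-1} h^(i-1) a i ^β + h^n ∑_{i=n}^{m-2} a i ^β + h^(n-1) a (m-1) ^β`. -/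
theorem theorem_3_4 (m n : ℕ) (a : ℕ → ℝ) (c α β h : ℝ)
    (hm : 3 ≤ m) (hn1 : 1 ≤ n) (hnm : n ≤ m - 1)
    (ha : ∀ i ∈ Icc 1 (m - 1), 0 ≤ a i) (hc : 0 ≤ c)
    (hsq : c ^ 2 = ∑ i ∈ Icc 1 (m - 1), a i ^ 2)
    (hle : ∀ i, 1 ≤ i → i ≤ n - 1 → a i ^ 2 ≤ ∑ j ∈ Icc (i + 1) (m - 1), a j ^ 2)
    (hge : ∀ j, n ≤ j → j ≤ m - 2 → a j ^ 2 ≥ ∑ k ∈ Icc (j + 1) (m - 1), a k ^ 2)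
    (hα : 2 ≤ α) (hβ0 : 0 ≤ β) (hβα : β ≤ α)
    (hh : h = 2 ^ (β / α) - 1) :
    c ^ β ≥ ∑ i ∈ Icc 1 (n - 1), h ^ (i - 1) * a i ^ β
      + h ^ n * ∑ i ∈ Icc n (m - 2), a i ^ β
      + h ^ (n - 1) * a (m - 1) ^ β := by
  set T : ℕ → ℝ := fun k => ∑ j ∈ Icc k (m - 1), a j ^ 2 with hT
  have rpow_sq : ∀ x : ℝ, 0 ≤ x → (x ^ 2) ^ (β / 2) = x ^ β := fun x hx => by
    rw [← Real.rpow_natCast, ← Real.rpow_mul hx]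
    congr 1
    push_cast
    ring
  have T_nonneg : ∀ k, 0 ≤ T k := fun k => sum_nonneg fun j _ => sq_nonneg _
  have T_succ : ∀ k, k ≤ m - 1 → T k = a k ^ 2 + T (k + 1) := fun k hk => by
    simp only [hT]
    rw [← add_sum_Ioc_eq_sum_Icc hk, Icc_add_one_left_eq_Ioc]
  have hh0 : 0 ≤ h := by
    rw [hh, sub_nonneg]
    exact Real.one_le_rpow one_le_two (div_nonneg hβ0 (by linarith))
  have head : ∀ k, k ≤ n - 1 →
      ∑ i ∈ Icc 1 k, h ^ (i - 1) * a i ^ β + h ^ k * T (k + 1) ^ (β / 2) ≤ T 1 ^ (β / 2) := by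
    intro k
    induction k with
    | zero => simp
    | succ k ih =>
      intro hk
      refine le_trans ?_ (ih (by omega))
      have step := rpow_half_add_mul_rpow_half_le (sq_nonneg (a (k + 1)))
        (hle (k + 1) (by omega) hk) hα hβ0 hβα
      rw [rpow_sq _ (ha _ (mem_Icc.2 ⟨by omega, by omega⟩)), ← hh] at step
      change _ + h * T (k + 1 + 1) ^ (β / 2) ≤ (_ + T (k + 1 + 1)) ^ (β / 2) at step
      rw [← T_succ _ (by omega)] at step
      rw [sum_Icc_succ_top (by omega), Nat.add_sub_cancel]
      linear_combination mul_le_mul_of_nonneg_left step (pow_nonneg hh0 k)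
  have tail : ∀ k, n ≤ k → k ≤ m - 1 →
      h * ∑ i ∈ Ico n k, a i ^ β + T k ^ (β / 2) ≤ T n ^ (β / 2) := by
    intro k hk
    induction k, hk using Nat.le_induction with
    | base => simp
    | succ k hk ih =>
      intro hkm
      refine le_trans ?_ (ih (by omega))
      have step := rpow_half_add_mul_rpow_half_le (T_nonneg (k + 1))
        (hge k hk (by omega)) hα hβ0 hβα
      rw [rpow_sq _ (ha _ (mem_Icc.2 ⟨by omega, by omega⟩)), ← hh, add_comm (T _),
        ← T_succ _ (by omega)] at step
      rw [sum_Ico_succ_top hk]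
      linear_combination step
  have hhead := head (n - 1) le_rfl
  have htail := tail (m - 1) hnm le_rfl
  have hT_last : T (m - 1) ^ (β / 2) = a (m - 1) ^ β := by
    simp only [hT, Icc_self, sum_singleton]
    exact rpow_sq _ (ha _ (mem_Icc.2 ⟨by omega, le_rfl⟩))
  have hIco : Ico n (m - 1) = Icc n (m - 2) := by
    ext i
    simp only [mem_Ico, mem_Icc]
    omega
  have hpow : h ^ n = h ^ (n - 1) * h := by rw [← pow_succ, Nat.sub_add_cancel hn1]
  rw [hT_last, hIco] at htail
  rw [Nat.sub_add_cancel hn1] at hhead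
  rw [ge_iff_le, ← rpow_sq c hc, hsq, hpow]
  change _ ≤ T 1 ^ (β / 2)
  linear_combination hhead + mul_le_mul_of_nonneg_left htail (pow_nonneg hh0 (n - 1))
end
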